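/- arXiv:2604.06963 — 8 statements merged into one kernel-verified Lean document; each statement's English description precedes it below -/
import Mathlib

section
/- Let ε be a completely multiplicative sign function and let m be a positive integer. Suppose that diff(m) consists of exactly one prime q. Then ∑_{d ∣ m, d > 0} ε(m/d)·log(d) = ((v_q(m)+1)/2)·log(q)·∏_{p ∣ m, p prime, ε(p)=1} (v_p(m)+1), where v_p(m) denotes the p-adic valuation of m and log is the real natural logarithm. -/
/-- `diff(m)`: the set of primes `p` with `ε p = -1` and odd `p`-adic valuation of `m`. -/
def diffSet (ε : ℕ → ℤ) (m : ℕ) : Set ℕ :=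
  {p | p.Prime ∧ ε p = -1 ∧ Odd (m.factorization p)}

theorem Nat.Coprime.sum_divisors_mul_eq_sum_sum {M : Type*} [AddCommMonoid M] {a b : ℕ}
    (hab : a.Coprime b) (f : ℕ → M) :
    ∑ d ∈ (a * b).divisors, f d = ∑ x ∈ a.divisors, ∑ y ∈ b.divisors, f (x * y) := by
  rw [← Finset.sum_product', hab.divisors_mul, Finset.sum_map]
  exact Finset.sum_attach (a.divisors ×ˢ b.divisors) fun p => f (p.1 * p.2)

theorem sum_range_two_mul_neg_one_pow_mul (t : ℕ) :
    ∑ x ∈ Finset.range (2 * t), (-1 : ℝ) ^ x * x = -t := by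
  induction t with
  | zero => simp
  | succ t ih =>
    rw [show 2 * (t + 1) = 2 * t + 1 + 1 by ring, Finset.sum_range_succ, Finset.sum_range_succ, ih,
      pow_succ, pow_mul]
    push_cast
    norm_num
    ring

section CompletelyMultiplicative

variable {ε : ℕ → ℤ}

theorem map_pow_of_map_mul (hε1 : ε 1 = 1)
    (hεmul : ∀ a b : ℕ, 0 < a → 0 < b → ε (a * b) = ε a * ε b) {a : ℕ} (ha : 0 < a) (k : ℕ) :
    ε (a ^ k) = ε a ^ k := by
  induction k with
  | zero => simpa using hε1
  | succ k ih => rw [pow_succ, hεmul _ _ (pow_pos ha k) ha, ih, pow_succ]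

theorem sum_divisors_eq_prod_sum_pow (hε1 : ε 1 = 1)
    (hεmul : ∀ a b : ℕ, 0 < a → 0 < b → ε (a * b) = ε a * ε b) {n : ℕ} (hn : n ≠ 0) :
    ∑ d ∈ n.divisors, ε d =
      ∏ p ∈ n.primeFactors, ∑ j ∈ Finset.range (n.factorization p + 1), ε p ^ j := by
  rw [Nat.multiplicative_factorization (fun n => ∑ d ∈ n.divisors, ε d) ?_ (by simpa using hε1) hn,
    Finsupp.prod, Nat.support_factorization]
  · refine Finset.prod_congr rfl fun p hp => ?_
    have hp' := Nat.prime_of_mem_primeFactors hp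
    rw [Nat.sum_divisors_prime_pow hp']
    exact Finset.sum_congr rfl fun j _ => map_pow_of_map_mul hε1 hεmul hp'.pos j
  · intro x y hxy
    rw [hxy.sum_divisors_mul_eq_sum_sum, Finset.sum_mul_sum]
    exact Finset.sum_congr rfl fun a ha => Finset.sum_congr rfl fun b hb =>
      hεmul a b (Nat.pos_of_mem_divisors ha) (Nat.pos_of_mem_divisors hb)

/-- If no prime with `ε p = -1` divides `n` to an odd power, then `∑_{d ∣ n} ε d` counts the
divisors of `n` supported at the primes with `ε p = 1`. -/
theorem sum_divisors_eq_prod_of_diffSet_eq_empty (hε1 : ε 1 = 1)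
    (hεmul : ∀ a b : ℕ, 0 < a → 0 < b → ε (a * b) = ε a * ε b)
    (hεsign : ∀ p : ℕ, p.Prime → ε p = 1 ∨ ε p = -1) {n : ℕ} (hn : n ≠ 0)
    (hdiff : diffSet ε n = ∅) :
    ∑ d ∈ n.divisors, ε d =
      ∏ p ∈ n.primeFactors.filter (fun p => ε p = 1), ((n.factorization p : ℤ) + 1) := by
  rw [sum_divisors_eq_prod_sum_pow hε1 hεmul hn, Finset.prod_filter]
  refine Finset.prod_congr rfl fun p hp => ?_
  have hp' := Nat.prime_of_mem_primeFactors hp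
  rcases hεsign p hp' with h | h
  · simp [h]
  · have heven : Even (n.factorization p) := by
      by_contra hodd
      exact Set.eq_empty_iff_forall_notMem.mp hdiff p ⟨hp', h, Nat.not_even_iff_odd.mp hodd⟩
    rw [h, neg_one_geom_sum, if_neg (by simpa [Nat.even_add_one] using heven)]
    norm_num

/-- Splitting off a prime `q` with `ε q = -1` that divides `m = q ^ k * n` to an odd power `k`. -/
theorem sum_divisors_mul_log_prime_pow_mul (hε1 : ε 1 = 1)
    (hεmul : ∀ a b : ℕ, 0 < a → 0 < b → ε (a * b) = ε a * ε b) {q k n : ℕ} (hq : q.Prime)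
    (hεq : ε q = -1) (hk : Odd k) (hn : n ≠ 0) (hqn : q.Coprime n) :
    ∑ d ∈ (q ^ k * n).divisors, (ε (q ^ k * n / d) : ℝ) * Real.log d =
      ((k : ℝ) + 1) / 2 * Real.log q * ((∑ d ∈ n.divisors, ε d : ℤ) : ℝ) := by
  obtain ⟨t, rfl⟩ := hk
  rw [(hqn.pow_left _).sum_divisors_mul_eq_sum_sum, Nat.sum_divisors_prime_pow hq]
  have hterm : ∀ x ∈ Finset.range (2 * t + 1 + 1), ∀ y ∈ n.divisors,
      (ε (q ^ (2 * t + 1) * n / (q ^ x * y)) : ℝ) * Real.log ((q ^ x * y : ℕ) : ℝ) =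
        -((-1) ^ x * x) * (Real.log q * ε (n / y)) -
          (-1) ^ x * (ε (n / y) * Real.log y) := by
    intro x hx y hy
    have hxk : x ≤ 2 * t + 1 := Nat.lt_succ_iff.mp (Finset.mem_range.mp hx)
    have hyn := Nat.dvd_of_mem_divisors hy
    have hy0 := Nat.pos_of_mem_divisors hy
    have hsign : ((-1 : ℝ)) ^ (2 * t + 1 - x) = -(-1) ^ x := by
      rcases Nat.even_or_odd x with h | h
      · rw [h.neg_one_pow, Odd.neg_one_pow (by grind)]
      · rw [h.neg_one_pow, Even.neg_one_pow (by grind), neg_neg]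
    rw [Nat.mul_div_mul_comm (pow_dvd_pow q hxk) hyn, Nat.pow_div hxk hq.pos,
      hεmul _ _ (pow_pos hq.pos _) (Nat.div_pos (Nat.le_of_dvd (Nat.pos_of_ne_zero hn) hyn) hy0),
      map_pow_of_map_mul hε1 hεmul hq.pos, hεq]
    push_cast
    rw [hsign, Real.log_mul (by exact_mod_cast (pow_pos hq.pos x).ne') (by exact_mod_cast hy0.ne'),
      Real.log_pow]
    ring
  rw [Finset.sum_congr rfl fun x hx => Finset.sum_congr rfl (hterm x hx)]
  simp only [Finset.sum_sub_distrib, ← Finset.mul_sum, ← Finset.sum_mul, Finset.sum_neg_distrib]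
  rw [show 2 * t + 1 + 1 = 2 * (t + 1) by ring, sum_range_two_mul_neg_one_pow_mul,
    neg_one_geom_sum, if_pos (even_two_mul _), Nat.sum_div_divisors n fun d => (ε d : ℝ)]
  push_cast
  ring

end CompletelyMultiplicative

/-- Gross–Zagier evaluation (p. 192): if `diff(m) = {q}` for a single prime `q`, then
`∑_{d ∣ m} ε(m/d) log d = ((v_q(m)+1)/2) log q · ∏_{p ∣ m, ε(p)=1} (v_p(m)+1)`. -/
theorem gz_sum_eq_of_diff_singleton (ε : ℕ → ℤ)
    (hε1 : ε 1 = 1)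
    (hεmul : ∀ a b : ℕ, 0 < a → 0 < b → ε (a * b) = ε a * ε b)
    (hεsign : ∀ p : ℕ, p.Prime → ε p = 1 ∨ ε p = -1)
    (m : ℕ) (hm : 0 < m) (q : ℕ) (hq : q.Prime)
    (hdiff : diffSet ε m = {q}) :
    ∑ d ∈ m.divisors, (ε (m / d) : ℝ) * Real.log d =
      ((m.factorization q : ℝ) + 1) / 2 * Real.log q *
        ∏ p ∈ m.primeFactors.filter (fun p => ε p = 1),
          ((m.factorization p : ℝ) + 1) := by
  obtain ⟨-, hεq, hodd⟩ : q ∈ diffSet ε m := hdiff ▸ Set.mem_singleton q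
  set n := ordCompl[q] m with hn_def
  have hn : n ≠ 0 := (Nat.ordCompl_pos q hm.ne').ne'
  have hfac : n.factorization = m.factorization.erase q := Nat.factorization_ordCompl m q
  have hdiff_n : diffSet ε n = ∅ := by
    refine Set.eq_empty_iff_forall_notMem.mpr fun p ⟨hp, hεp, hpodd⟩ => ?_
    rw [hfac] at hpodd
    rcases eq_or_ne p q with rfl | hpq
    · simp at hpodd
    · rw [Finsupp.erase_ne hpq] at hpodd
      exact hpq (Set.mem_singleton_iff.mp (hdiff ▸ (⟨hp, hεp, hpodd⟩ : p ∈ diffSet ε m)))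
  have hsum := sum_divisors_mul_log_prime_pow_mul hε1 hεmul hq hεq hodd hn
    (Nat.coprime_ordCompl hq hm.ne')
  rw [hn_def, Nat.ordProj_mul_ordCompl_eq_self, ← hn_def] at hsum
  rw [hsum, sum_divisors_eq_prod_of_diffSet_eq_empty hε1 hεmul hεsign hn hdiff_n]
  push_cast
  have hfilter : n.primeFactors.filter (fun p => ε p = 1) =
      m.primeFactors.filter (fun p => ε p = 1) := by
    rw [← Nat.support_factorization, hfac, Finsupp.support_erase, Nat.support_factorization,
      Finset.filter_erase, Finset.erase_eq_of_notMem]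
    simp [hεq]
  rw [hfilter]
  congr 1
  refine Finset.prod_congr rfl fun p hp => ?_
  have hpq : p ≠ q := by
    rintro rfl
    simp [hεq] at hp
  rw [hfac, Finsupp.erase_ne hpq]
end

section
/- Let p be a prime and R a commutative ring of characteristic p. Let f ∈ R[X] be a polynomial of degree strictly less than p whose coefficients of X⁰ and X¹ both vanish. If f is additive, i.e. f(X+Y) = f(X) + f(Y) holds in the polynomial ring R[X,Y], then f = 0. -/
open Polynomial in
/-- The derivative of an additive polynomial is constant: compare the coefficients of `Y` in
`f(X + Y) = f(X) + f(Y)`. -/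
theorem derivative_eq_C_coeff_one_of_additive {R : Type*} [CommRing R] (f : R[X])
    (hadd : aeval (MvPolynomial.X 0 + MvPolynomial.X 1 : MvPolynomial (Fin 2) R) f
      = aeval (MvPolynomial.X 0 : MvPolynomial (Fin 2) R) f
      + aeval (MvPolynomial.X 1 : MvPolynomial (Fin 2) R) f) :
    derivative f = C (f.coeff 1) := by
  have h := congrArg (MvPolynomial.aeval ![C X, (X : R[X][X])]) hadd
  simp only [map_add, ← aeval_algHom_apply, MvPolynomial.aeval_X, Matrix.cons_val_zero,
    Matrix.cons_val_one] at h
  have h_taylor : aeval (C X + X : R[X][X]) f = taylor X (f.map C) := by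
    rw [taylor_apply, comp, eval₂_map, add_comm, aeval_def]
    rfl
  have h_const : aeval (C X : R[X][X]) f = C f := by
    rw [← algebraMap_eq (R := R[X]), aeval_algebraMap_apply, aeval_X_left_apply]
  have h_map : aeval (X : R[X][X]) f = f.map C := by
    rw [aeval_def, map, ← algebraMap_eq (R := R)]
    rfl
  rw [h_taylor, h_const, h_map] at h
  have h_coeff := congrArg (coeff · 1) h
  simpa [taylor_coeff_one, derivative_map, coeff_C, eval_map, eval₂_C_X] using h_coeff

/-- An additive polynomial over a commutative ring of characteristic `p`, of degree `< p`,
with vanishing coefficients in degrees `0` and `1`, is zero.  (Key computation in the proof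
that `End(α_p / R) ≅ R`, Lemma 2.1.) -/
theorem additive_poly_of_degree_lt_char_eq_zero
    (p : ℕ) (hp : p.Prime) (R : Type*) [CommRing R] [CharP R p]
    (f : Polynomial R) (hdeg : f.natDegree < p)
    (h0 : f.coeff 0 = 0) (h1 : f.coeff 1 = 0)
    (hadd : Polynomial.aeval (MvPolynomial.X 0 + MvPolynomial.X 1 : MvPolynomial (Fin 2) R) f
      = Polynomial.aeval (MvPolynomial.X 0 : MvPolynomial (Fin 2) R) f
      + Polynomial.aeval (MvPolynomial.X 1 : MvPolynomial (Fin 2) R) f) :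
    f = 0 := by
  have hder : Polynomial.derivative f = 0 := by
    rw [derivative_eq_C_coeff_one_of_additive f hadd, h1, Polynomial.C_0]
  ext n
  rw [Polynomial.coeff_zero]
  rcases n with _ | n
  · exact h0
  rcases lt_or_ge (n + 1) p with hn | hn
  · have hunit : IsUnit ((n + 1 : ℕ) : R) :=
      (CharP.isUnit_natCast_iff hp).2 (Nat.not_dvd_of_pos_of_lt n.succ_pos hn)
    have hmul := Polynomial.coeff_derivative f n
    rw [hder, Polynomial.coeff_zero, ← Nat.cast_succ] at hmul
    exact hunit.mul_left_eq_zero.1 hmul.symm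
  · exact Polynomial.coeff_eq_zero_of_natDegree_lt (hdeg.trans_le hn)
end

section
/- Let p be a prime and n ≥ 1 an integer. Set W := 𝕎(𝔽_{p²}) and Q := W/(pⁿ), and let F : Q → Q be the ring endomorphism induced by the Witt vector Frobenius of W (which maps the ideal (pⁿ) into itself, since it is a ring homomorphism fixing p). Then for every (possibly noncommutative, unital) ring R and every ring homomorphism α : Q → R such that α(p^{n−1}·1) ≠ 0 in R, the map α is injective and α ∘ F ≠ α. -/
open WittVector

/-- The Frobenius `x ↦ x ^ p` is not the identity on `𝔽_{p^k}` when `k > 1`. -/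
theorem GaloisField.exists_pow_ne_self (p : ℕ) [Fact p.Prime] {k : ℕ} (hk : 1 < k) :
    ∃ a : GaloisField p k, a ^ p ≠ a := by
  by_contra! h
  have h1 : FiniteField.frobeniusAlgHom (ZMod p) (GaloisField p k) = 1 := by
    ext a
    simp [h]
  have h2 := FiniteField.orderOf_frobeniusAlgHom (ZMod p) (GaloisField p k)
  rw [h1, orderOf_one, GaloisField.finrank p (by lia)] at h2
  lia

/-- A ring homomorphism out of `𝕎 k / (p ^ n)`, for `k` a perfect field, is injective as soon as
it does not kill `p ^ (n - 1)`. -/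
theorem WittVector.injective_of_map_p_pow_ne_zero {p : ℕ} [Fact p.Prime] {k : Type*} [Field k]
    [CharP k p] [PerfectRing k p] {n : ℕ} {R : Type*} [Ring R]
    (α : (WittVector p k ⧸ Ideal.span {(p : WittVector p k) ^ n}) →+* R)
    (hα : α ((p : WittVector p k ⧸ Ideal.span {(p : WittVector p k) ^ n}) ^ (n - 1)) ≠ 0) :
    Function.Injective α := by
  rw [injective_iff_map_eq_zero]
  intro q hq
  obtain ⟨x, rfl⟩ := Ideal.Quotient.mk_surjective q
  by_cases hx : x = 0
  · simp [hx]
  obtain ⟨m, u, rfl⟩ := WittVector.exists_eq_pow_p_mul' x hx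
  rw [Ideal.Quotient.eq_zero_iff_dvd]
  by_contra hdvd
  have hm : m ≤ n - 1 := by
    by_contra! hm
    exact hdvd ((pow_dvd_pow _ (by lia)).mul_right _)
  apply hα
  have key : (p : WittVector p k ⧸ Ideal.span {(p : WittVector p k) ^ n}) ^ (n - 1) =
      Ideal.Quotient.mk _ ((p : WittVector p k) ^ m * u) *
        Ideal.Quotient.mk _ ((p : WittVector p k) ^ (n - 1 - m) * (u⁻¹ : (WittVector p k)ˣ)) := by
    rw [← map_mul, mul_mul_mul_comm, Units.mul_inv, mul_one, ← pow_add,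
      Nat.add_sub_cancel' hm, map_pow, map_natCast]
  rw [key, map_mul, hq, zero_mul]

/-- Let `Q = ℤ_{p²}/(pⁿ) = 𝕎(𝔽_{p²})/(pⁿ)` and let `F : Q →+* Q` be the ring endomorphism
induced by the Witt vector Frobenius.  If `α : Q →+* R` is a ring homomorphism into a
(possibly noncommutative) ring `R` with `α(p^{n-1}) ≠ 0`, then `α` is injective and
`α ∘ F ≠ α`.  (Remark following Definition 2.5.) -/
theorem injective_and_frobenius_twist_ne (p : ℕ) [Fact p.Prime] (n : ℕ) (hn : 1 ≤ n)
    (F : (WittVector p (GaloisField p 2) ⧸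
        Ideal.span {(p : WittVector p (GaloisField p 2)) ^ n}) →+*
      (WittVector p (GaloisField p 2) ⧸
        Ideal.span {(p : WittVector p (GaloisField p 2)) ^ n}))
    (hF : ∀ x : WittVector p (GaloisField p 2),
      F (Ideal.Quotient.mk (Ideal.span {(p : WittVector p (GaloisField p 2)) ^ n}) x) =
        Ideal.Quotient.mk (Ideal.span {(p : WittVector p (GaloisField p 2)) ^ n})
          (WittVector.frobenius x))
    (R : Type*) [Ring R]
    (α : (WittVector p (GaloisField p 2) ⧸
        Ideal.span {(p : WittVector p (GaloisField p 2)) ^ n}) →+* R)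
    (hα : α ((p : WittVector p (GaloisField p 2) ⧸
        Ideal.span {(p : WittVector p (GaloisField p 2)) ^ n}) ^ (n - 1)) ≠ 0) :
    Function.Injective α ∧ α.comp F ≠ α := by
  have hinj := WittVector.injective_of_map_p_pow_ne_zero α hα
  refine ⟨hinj, fun h ↦ ?_⟩
  obtain ⟨a, ha⟩ := GaloisField.exists_pow_ne_self p one_lt_two
  have hfix := hinj (RingHom.congr_fun h (Ideal.Quotient.mk _ (WittVector.teichmuller p a)))
  rw [hF, Ideal.Quotient.eq, Ideal.mem_span_singleton] at hfix
  have hc := map_dvd (WittVector.constantCoeff (p := p) (R := GaloisField p 2)) hfix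
  rw [map_pow, map_natCast, CharP.cast_eq_zero, zero_pow (by lia), zero_dvd_iff, map_sub,
    sub_eq_zero] at hc
  apply ha
  simpa [WittVector.constantCoeff, WittVector.coeff_frobenius_charP] using hc
end

section
/- Let p be a prime and let a, b be integers such that the reduced polynomial X² + āX + b̄ ∈ 𝔽_p[X] is irreducible, where bars denote reduction modulo p. Let R be a nontrivial commutative ring of characteristic p and let ζ ∈ R satisfy ζ² + aζ + b = 0 (with a and b regarded in R via the unique map ℤ → R). Then ζ^p − ζ is a unit of R. -/
open Polynomial

theorem isCoprime_X_pow_card_sub_X_of_irreducible {K : Type*} [Field K] [Fintype K] {f : K[X]}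
    (hf : Irreducible f) (hdeg : f.degree ≠ 1) : IsCoprime f (X ^ Fintype.card K - X) := by
  rw [hf.coprime_iff_not_dvd]
  intro hdvd
  have hsplits : (X ^ Fintype.card K - X : K[X]).Splits := by
    rw [splits_iff_card_roots, FiniteField.roots_X_pow_card_sub_X,
      FiniteField.X_pow_card_sub_X_natDegree_eq K Fintype.one_lt_card]
    rfl
  exact hdeg <| (hsplits.of_dvd
    (FiniteField.X_pow_card_sub_X_ne_zero K Fintype.one_lt_card) hdvd).degree_eq_one_of_irreducible
    hf

/-- Let `p` be prime and `a b : ℤ` with `X² + āX + b̄` irreducible over `𝔽_p`.  If `R` is a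
nontrivial commutative ring of characteristic `p` and `ζ ∈ R` satisfies `ζ² + aζ + b = 0`,
then `ζ^p − ζ` is a unit of `R`.  (Step in the proof of Lemma 2.10.) -/
theorem pow_p_sub_self_isUnit
    (p : ℕ) (hp : p.Prime) (a b : ℤ)
    (hirr : Irreducible (X ^ 2 + C (a : ZMod p) * X + C (b : ZMod p) : Polynomial (ZMod p)))
    (R : Type*) [CommRing R] [Nontrivial R] [CharP R p]
    (ζ : R) (hζ : ζ ^ 2 + (a : R) * ζ + (b : R) = 0) :
    IsUnit (ζ ^ p - ζ) := by
  have : Fact p.Prime := ⟨hp⟩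
  algebraize [ZMod.castHom dvd_rfl R]
  have hdeg : (X ^ 2 + C (a : ZMod p) * X + C (b : ZMod p)).degree ≠ 1 := by
    have h : (X ^ 2 + C (a : ZMod p) * X + C (b : ZMod p)).degree = 2 := by compute_degree!
    rw [h]; decide
  have hcop := (isCoprime_X_pow_card_sub_X_of_irreducible hirr hdeg).map
    (aeval ζ : (ZMod p)[X] →ₐ[ZMod p] R).toRingHom
  simpa [hζ, ZMod.card, isCoprime_zero_left] using hcop
end

section
/- With Δ₁, Δ₂, t, B, e₁, e₂, γ₁, γ₂ as in the Clifford-order setup, the ℤ-submodule S_t := span_ℤ{1, γ₁, γ₂, γ₁γ₂} of B is closed under multiplication; since it contains 1, it is a subring of B (the Clifford order S_t generated by the embedded quadratic orders ℤ[γ₁] and ℤ[γ₂]). -/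
open Quaternion

noncomputable section

/-- The Clifford algebra `B_t` of the binary quadratic form `Δ₁X² + 2tXY + Δ₂Y²`,
realized as the quaternion algebra over `ℚ` with `i² = Δ₁`, `j² = Δ₂ − t²/Δ₁`. -/
abbrev Bt (Δ₁ Δ₂ t : ℤ) : Type :=
  ℍ[ℚ, (Δ₁ : ℚ), (Δ₂ : ℚ) - (t : ℚ) ^ 2 / (Δ₁ : ℚ)]

/-- `e₁ := i`, satisfying `e₁² = Δ₁`. -/
def e₁ (Δ₁ Δ₂ t : ℤ) : Bt Δ₁ Δ₂ t := ⟨0, 1, 0, 0⟩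

/-- `e₂ := (t/Δ₁)·i + j`, satisfying `e₂² = Δ₂` and `e₁e₂ + e₂e₁ = 2t`. -/
def e₂ (Δ₁ Δ₂ t : ℤ) : Bt Δ₁ Δ₂ t := ⟨0, (t : ℚ) / (Δ₁ : ℚ), 1, 0⟩

/-- `γ₁ := (Δ₁ + e₁)/2`. -/
def γ₁ (Δ₁ Δ₂ t : ℤ) : Bt Δ₁ Δ₂ t := (2 : ℚ)⁻¹ • (((Δ₁ : ℤ) : Bt Δ₁ Δ₂ t) + e₁ Δ₁ Δ₂ t)

/-- `γ₂ := (Δ₂ + e₂)/2`. -/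
def γ₂ (Δ₁ Δ₂ t : ℤ) : Bt Δ₁ Δ₂ t := (2 : ℚ)⁻¹ • (((Δ₂ : ℤ) : Bt Δ₁ Δ₂ t) + e₂ Δ₁ Δ₂ t)

/-- If `a` and `b` are integral quadratic elements of a ring and `b * a` is an integral combination
of `1`, `a`, `b`, `a * b`, with coefficient `-1` at `a * b`, then the `ℤ`-span of `1`, `a`, `b`,
`a * b` is closed under multiplication. -/
theorem mul_mem_span_of_quadratic_relations {R : Type*} [Ring R] {a b : R} {p q r s u v w : ℤ}
    (ha : a * a = p • a + q • 1) (hb : b * b = r • b + s • 1)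
    (hba : b * a = -(a * b) + u • a + v • b + w • 1) {x y : R}
    (hx : x ∈ Submodule.span ℤ ({1, a, b, a * b} : Set R))
    (hy : y ∈ Submodule.span ℤ ({1, a, b, a * b} : Set R)) :
    x * y ∈ Submodule.span ℤ ({1, a, b, a * b} : Set R) := by
  have key (k l m n : ℤ) :
      k • 1 + l • a + m • b + n • (a * b) ∈ Submodule.span ℤ ({1, a, b, a * b} : Set R) := by
    refine add_mem (add_mem (add_mem ?_ ?_) ?_) ?_ <;>
      exact Submodule.smul_mem _ _ (Submodule.subset_span (by simp))
  have haab : a * (a * b) = p • (a * b) + q • b := by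
    rw [← mul_assoc, ha, add_mul, smul_mul_assoc, smul_mul_assoc, one_mul]
  have habb : a * b * b = r • (a * b) + s • a := by
    rw [mul_assoc, hb, mul_add, mul_smul_comm, mul_smul_comm, mul_one]
  have haba : a * b * a = (u * q) • 1 + (u * p + w) • a + (-q) • b + (v - p) • (a * b) := by
    rw [mul_assoc, hba]
    simp only [mul_add, mul_neg, mul_smul_comm, mul_one, haab, ha]
    module
  have hbab : b * (a * b) = (v * s) • 1 + (-s) • a + (v * r + w) • b + (u - r) • (a * b) := by
    rw [← mul_assoc, hba]
    simp only [add_mul, neg_mul, smul_mul_assoc, one_mul, habb, hb]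
    module
  have habab : a * b * (a * b) =
      (-(q * s)) • 1 + (v * s - p * s) • a + (u * q - q * r) • b +
        (u * p + v * r + w - p * r) • (a * b) := by
    rw [← mul_assoc, haba]
    simp only [add_mul, smul_mul_assoc, one_mul, habb, hb]
    module
  have h := Submodule.mul_mem_mul hx hy
  rw [Submodule.span_mul_span] at h
  refine Submodule.span_le.2 ?_ h
  rintro _ ⟨c, hc, d, hd, rfl⟩
  simp only [Set.mem_insert_iff, Set.mem_singleton_iff] at hc hd
  change c * d ∈ Submodule.span ℤ ({1, a, b, a * b} : Set R)
  rcases hc with rfl | rfl | rfl | rfl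
  · rw [one_mul]
    exact Submodule.subset_span hd
  · rcases hd with rfl | rfl | rfl | rfl
    · convert key 0 1 0 0 using 1; simp
    · convert key q p 0 0 using 1; rw [ha]; module
    · convert key 0 0 0 1 using 1; simp
    · convert key 0 0 q p using 1; rw [haab]; module
  · rcases hd with rfl | rfl | rfl | rfl
    · convert key 0 0 1 0 using 1; simp
    · convert key w u v (-1) using 1; rw [hba]; module
    · convert key s 0 r 0 using 1; rw [hb]; module
    · rw [hbab]; exact key _ _ _ _
  · rcases hd with rfl | rfl | rfl | rfl
    · convert key 0 0 0 1 using 1; simp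
    · rw [haba]; exact key _ _ _ _
    · convert key 0 s 0 r using 1; rw [habb]; module
    · rw [habab]; exact key _ _ _ _

theorem e₁_mul_e₁ (Δ₁ Δ₂ t : ℤ) : e₁ Δ₁ Δ₂ t * e₁ Δ₁ Δ₂ t = (Δ₁ : Bt Δ₁ Δ₂ t) := by
  ext <;> simp [e₁]

theorem e₂_mul_e₂ {Δ₁ : ℤ} (hΔ₁ : Δ₁ ≠ 0) (Δ₂ t : ℤ) :
    e₂ Δ₁ Δ₂ t * e₂ Δ₁ Δ₂ t = (Δ₂ : Bt Δ₁ Δ₂ t) := by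
  have h : (Δ₁ : ℚ) ≠ 0 := by exact_mod_cast hΔ₁
  ext <;> simp [e₂]
  field_simp
  ring

theorem e₂_mul_e₁ {Δ₁ : ℤ} (hΔ₁ : Δ₁ ≠ 0) (Δ₂ t : ℤ) :
    e₂ Δ₁ Δ₂ t * e₁ Δ₁ Δ₂ t =
      -(e₁ Δ₁ Δ₂ t * e₂ Δ₁ Δ₂ t) + ((2 * t : ℤ) : Bt Δ₁ Δ₂ t) := by
  have h : (Δ₁ : ℚ) ≠ 0 := by exact_mod_cast hΔ₁
  ext <;> simp [e₁, e₂, -Int.cast_mul]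
  field_simp
  ring

/-- An element `(d + e) / 2` with `e ^ 2 = d` and `d ^ 2 - d = 4 m` is a root of
`X ^ 2 - d X + m`. -/
theorem half_add_mul_self {R : Type*} [Ring R] [Algebra ℚ R] {d m : ℤ} {e : R}
    (he : e * e = d) (hm : d * d - d = 4 * m) :
    ((2 : ℚ)⁻¹ • ((d : R) + e)) * ((2 : ℚ)⁻¹ • ((d : R) + e)) =
      d • ((2 : ℚ)⁻¹ • ((d : R) + e)) + (-m) • (1 : R) := by
  have hm' : (m : ℚ) = (d * d - d) / 4 := by
    have : (d : ℚ) * d - d = 4 * m := by exact_mod_cast hm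
    linarith
  have hd : (d : R) = (d : ℚ) • (1 : R) := by simp [Algebra.smul_def]
  rw [hd] at he ⊢
  simp only [← Int.cast_smul_eq_zsmul ℚ, Int.cast_neg, smul_mul_assoc, mul_smul_comm, add_mul,
    mul_add, one_mul, mul_one, he, hm']
  module

/-- The anticommutation relation between `(d₁ + f₁) / 2` and `(d₂ + f₂) / 2` when
`f₁ f₂ + f₂ f₁ = 2 t` and `t - d₁ d₂ = 2 m`. -/
theorem half_add_mul_half_add {R : Type*} [Ring R] [Algebra ℚ R] {d₁ d₂ t m : ℤ} {f₁ f₂ : R}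
    (hf : f₂ * f₁ = -(f₁ * f₂) + ((2 * t : ℤ) : R)) (hm : t - d₁ * d₂ = 2 * m) :
    ((2 : ℚ)⁻¹ • ((d₂ : R) + f₂)) * ((2 : ℚ)⁻¹ • ((d₁ : R) + f₁)) =
      -(((2 : ℚ)⁻¹ • ((d₁ : R) + f₁)) * ((2 : ℚ)⁻¹ • ((d₂ : R) + f₂))) +
        d₂ • ((2 : ℚ)⁻¹ • ((d₁ : R) + f₁)) + d₁ • ((2 : ℚ)⁻¹ • ((d₂ : R) + f₂)) +
          m • (1 : R) := by
  have hm' : (m : ℚ) = (t - d₁ * d₂) / 2 := by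
    have : (t : ℚ) - d₁ * d₂ = 2 * m := by exact_mod_cast hm
    linarith
  have hc (n : ℤ) : (n : R) = (n : ℚ) • (1 : R) := by simp [Algebra.smul_def]
  rw [hc] at hf
  rw [hc, hc]
  simp only [← Int.cast_smul_eq_zsmul ℚ, smul_mul_assoc, mul_smul_comm, add_mul,
    mul_add, one_mul, mul_one, hf, hm', Int.cast_mul, Int.cast_ofNat]
  module

theorem exists_mul_self_sub_self_eq_four_mul {d : ℤ} (hd : d % 4 = 0 ∨ d % 4 = 1) :
    ∃ m, d * d - d = 4 * m := by
  rcases hd with h | h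
  · exact ⟨d / 4 * (d - 1), by
      linear_combination (d - 1) * h - (d - 1) * Int.emod_add_mul_ediv d 4⟩
  · exact ⟨d / 4 * d, by linear_combination d * h - d * Int.emod_add_mul_ediv d 4⟩

/-- The ℤ-span of `1, γ₁, γ₂, γ₁γ₂` in `B_t` is closed under multiplication, hence is a
subring of `B_t`: the Clifford order `S_t`. -/
theorem cliffordOrder_mul_mem (Δ₁ Δ₂ t : ℤ)
    (hΔ₁ : Δ₁ < 0) (hΔ₂ : Δ₂ < 0)
    (hΔ₁mod : Δ₁ % 4 = 0 ∨ Δ₁ % 4 = 1) (hΔ₂mod : Δ₂ % 4 = 0 ∨ Δ₂ % 4 = 1)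
    (ht : t % 2 = (Δ₁ * Δ₂) % 2) (ht2 : t ^ 2 ≠ Δ₁ * Δ₂) :
    ∀ x ∈ Submodule.span ℤ
        ({1, γ₁ Δ₁ Δ₂ t, γ₂ Δ₁ Δ₂ t, γ₁ Δ₁ Δ₂ t * γ₂ Δ₁ Δ₂ t} : Set (Bt Δ₁ Δ₂ t)),
      ∀ y ∈ Submodule.span ℤ
        ({1, γ₁ Δ₁ Δ₂ t, γ₂ Δ₁ Δ₂ t, γ₁ Δ₁ Δ₂ t * γ₂ Δ₁ Δ₂ t} : Set (Bt Δ₁ Δ₂ t)),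
      x * y ∈ Submodule.span ℤ
        ({1, γ₁ Δ₁ Δ₂ t, γ₂ Δ₁ Δ₂ t, γ₁ Δ₁ Δ₂ t * γ₂ Δ₁ Δ₂ t} : Set (Bt Δ₁ Δ₂ t)) := by
  obtain ⟨m₁, hm₁⟩ := exists_mul_self_sub_self_eq_four_mul hΔ₁mod
  obtain ⟨m₂, hm₂⟩ := exists_mul_self_sub_self_eq_four_mul hΔ₂mod
  obtain ⟨m, hm⟩ : ∃ m, t - Δ₁ * Δ₂ = 2 * m := ⟨(t - Δ₁ * Δ₂) / 2, by lia⟩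
  intro x hx y hy
  exact mul_mem_span_of_quadratic_relations
    (half_add_mul_self (e₁_mul_e₁ Δ₁ Δ₂ t) hm₁)
    (half_add_mul_self (e₂_mul_e₂ hΔ₁.ne Δ₂ t) hm₂)
    (half_add_mul_half_add (e₂_mul_e₁ hΔ₁.ne Δ₂ t) hm) hx hy
end
end

section
/- With Δ₁, Δ₂, t, B, e₁, e₂, γ₁, γ₂ as in the Clifford-order setup, the discriminant (in the sense of Algebra.discr, i.e. the determinant of the matrix of algebra traces Tr_{B/ℚ}(b_r·b_s)) of the ℚ-basis (1, γ₁, γ₂, γ₁γ₂) of B equals −(t² − Δ₁Δ₂)². (Equivalently, the reduced discriminant of the Clifford order S_t = ℤ + ℤγ₁ + ℤγ₂ + ℤγ₁γ₂ is |t² − Δ₁Δ₂|/4, as asserted in equation (4.2) of the paper.) -/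
open Quaternion

noncomputable section

/-- The basis `(1, γ₁, γ₂, γ₁γ₂)` of `B_t` over `ℚ`. -/
def cliffordBasis (Δ₁ Δ₂ t : ℤ) : Fin 4 → Bt Δ₁ Δ₂ t :=
  ![1, γ₁ Δ₁ Δ₂ t, γ₂ Δ₁ Δ₂ t, γ₁ Δ₁ Δ₂ t * γ₂ Δ₁ Δ₂ t]

/-- The trace of left multiplication on a quaternion algebra is four times the real part. -/
theorem trace_mulLeft_quaternionAlgebra {R : Type*} [CommRing R] (a b : R) (x : ℍ[R, a, b]) :
    LinearMap.trace R ℍ[R, a, b] (LinearMap.mulLeft R x) = 4 * x.re := by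
  rw [LinearMap.trace_eq_matrix_trace R (QuaternionAlgebra.basisOneIJK a 0 b)]
  have hb : ∀ n, QuaternionAlgebra.basisOneIJK a 0 b n =
      (![⟨1, 0, 0, 0⟩, ⟨0, 1, 0, 0⟩, ⟨0, 0, 1, 0⟩, ⟨0, 0, 0, 1⟩] : Fin 4 → ℍ[R, a, b]) n := by
    intro n
    apply (QuaternionAlgebra.basisOneIJK a 0 b).repr.injective
    ext m
    rw [Module.Basis.repr_self, QuaternionAlgebra.coe_basisOneIJK_repr]
    fin_cases n <;> fin_cases m <;> simp
  simp only [Matrix.trace, Matrix.diag, LinearMap.toMatrix_apply, LinearMap.mulLeft_apply,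
    QuaternionAlgebra.coe_basisOneIJK_repr, hb, Fin.sum_univ_four]
  simp
  ring

/-- The discriminant (determinant of the matrix of algebra traces, where the algebra trace
of `x` is the trace of left multiplication by `x` on `B_t`) of the basis
`(1, γ₁, γ₂, γ₁γ₂)` equals `−(t² − Δ₁Δ₂)²`; equivalently, the reduced discriminant of the
Clifford order `S_t` is `(t² − Δ₁Δ₂)/4` in absolute value. -/
theorem discr_cliffordBasis (Δ₁ Δ₂ t : ℤ)
    (hΔ₁ : Δ₁ < 0) (hΔ₂ : Δ₂ < 0)
    (hΔ₁mod : Δ₁ % 4 = 0 ∨ Δ₁ % 4 = 1) (hΔ₂mod : Δ₂ % 4 = 0 ∨ Δ₂ % 4 = 1)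
    (ht : t % 2 = (Δ₁ * Δ₂) % 2) (ht2 : t ^ 2 ≠ Δ₁ * Δ₂) :
    Matrix.det (Matrix.of fun r s : Fin 4 =>
        LinearMap.trace ℚ (Bt Δ₁ Δ₂ t)
          (LinearMap.mulLeft ℚ (cliffordBasis Δ₁ Δ₂ t r * cliffordBasis Δ₁ Δ₂ t s))) =
      -(((t : ℚ) ^ 2 - (Δ₁ : ℚ) * (Δ₂ : ℚ)) ^ 2) := by
  have h₁ : (Δ₁ : ℚ) ≠ 0 := by exact_mod_cast hΔ₁.ne
  simp only [trace_mulLeft_quaternionAlgebra, Matrix.det_succ_row_zero, Fin.sum_univ_succ]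
  simp [cliffordBasis, γ₁, γ₂, e₁, e₂, Fin.succAbove]
  field_simp
  ring
end
end

section
/- For every g ∈ GL₂(𝔽₅) with gAg⁻¹ = A, there exists a nonzero element h ∈ A such that gA₂g⁻¹ = hA₂h⁻¹. In other words, all 48 elements of the normalizer of A in GL₂(𝔽₅) preserve the orbit of the subalgebra A₂ under conjugation by units of A. -/
/-- The non-split Cartan subalgebra `A = {[[a,2b],[b,a]]} ⊆ M₂(𝔽₅)`. -/
def cartanA : Set (Matrix (Fin 2) (Fin 2) (ZMod 5)) :=
  {m | ∃ a b : ZMod 5, m = !![a, 2 * b; b, a]}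

/-- The second non-split Cartan subalgebra `A₂ = {[[a,3b],[b,a]]} ⊆ M₂(𝔽₅)`. -/
def cartanA₂ : Set (Matrix (Fin 2) (Fin 2) (ZMod 5)) :=
  {m | ∃ a b : ZMod 5, m = !![a, 3 * b; b, a]}

/-- Conjugation of a subset of `M₂(𝔽₅)` by an element `u`:
`uSu⁻¹` (with `u⁻¹` the inverse of `u` when `u` is a unit, via `Ring.inverse`). -/
def conjSet (u : Matrix (Fin 2) (Fin 2) (ZMod 5))
    (S : Set (Matrix (Fin 2) (Fin 2) (ZMod 5))) : Set (Matrix (Fin 2) (Fin 2) (ZMod 5)) :=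
  (fun s => u * s * Ring.inverse u) '' S

theorem conjSet_units_mul (u v : (Matrix (Fin 2) (Fin 2) (ZMod 5))ˣ)
    (S : Set (Matrix (Fin 2) (Fin 2) (ZMod 5))) :
    conjSet ↑(u * v) S = conjSet ↑u (conjSet ↑v S) := by
  simp only [conjSet, Set.image_image, Ring.inverse_unit]
  simp only [mul_inv_rev, Units.val_mul, mul_assoc]

/-- The reflection `diag(1, -1)`. -/
def cartanReflection : (Matrix (Fin 2) (Fin 2) (ZMod 5))ˣ where
  val := !![1, 0; 0, -1]
  inv := !![1, 0; 0, -1]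
  val_inv := by decide
  inv_val := by decide

theorem conjSet_cartanReflection_cartanA₂ : conjSet ↑cartanReflection cartanA₂ = cartanA₂ := by
  have key (a b : ZMod 5) :
      (cartanReflection : Matrix (Fin 2) (Fin 2) (ZMod 5)) * !![a, 3 * b; b, a] *
        (cartanReflection⁻¹ : (Matrix (Fin 2) (Fin 2) (ZMod 5))ˣ) = !![a, 3 * -b; -b, a] := by
    simp [cartanReflection]
  ext m
  simp only [conjSet, Ring.inverse_unit]
  constructor
  · rintro ⟨_, ⟨a, b, rfl⟩, rfl⟩
    exact ⟨a, -b, key a b⟩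
  · rintro ⟨a, b, rfl⟩
    exact ⟨_, ⟨a, -b, rfl⟩, by simpa using key a (-b)⟩

/-- The square roots of `2` in `𝔽₂₅ = 𝔽₅(√2)` are `±√2`. -/
theorem eq_of_sq_eq_two {a b : ZMod 5} (h₁ : a * a + 2 * b * b = 2) (h₂ : b * a + a * b = 0) :
    a = 0 ∧ (b = 1 ∨ b = -1) := by
  revert a b
  decide

/-- The normalizer of `A` consists of `Aˣ` and its translate by the reflection. -/
theorem mem_cartanA_or_mul_cartanReflection_mem (g : (Matrix (Fin 2) (Fin 2) (ZMod 5))ˣ)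
    (hg : conjSet ↑g cartanA = cartanA) :
    (g : Matrix (Fin 2) (Fin 2) (ZMod 5)) ∈ cartanA ∨
      ((g * cartanReflection : (Matrix (Fin 2) (Fin 2) (ZMod 5))ˣ) :
        Matrix (Fin 2) (Fin 2) (ZMod 5)) ∈ cartanA := by
  set w : Matrix (Fin 2) (Fin 2) (ZMod 5) := !![0, 2; 1, 0] with hw
  have hwA : w ∈ cartanA := ⟨0, 1, by simp [hw]⟩
  obtain ⟨a, b, hab⟩ : g.val * w * Ring.inverse g.val ∈ cartanA :=
    hg.subset ⟨w, hwA, rfl⟩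
  rw [Ring.inverse_unit, Units.mul_inv_eq_iff_eq_mul] at hab
  have hsq : !![a, 2 * b; b, a] * !![a, 2 * b; b, a] = !![2, 0; 0, 2] := by
    have hww : w * w = (2 : ZMod 5) • 1 := by decide
    have hscalar : !![2, 0; 0, 2] = (2 : ZMod 5) • (1 : Matrix (Fin 2) (Fin 2) (ZMod 5)) := by
      decide
    have h : !![a, 2 * b; b, a] * !![a, 2 * b; b, a] * g.val = !![2, 0; 0, 2] * g.val := by
      rw [mul_assoc, ← hab, ← mul_assoc, ← hab, mul_assoc, hww, hscalar, mul_smul_comm,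
        smul_mul_assoc, mul_one, one_mul]
    exact g.isUnit.mul_right_cancel h
  have h₁ := congrFun (congrFun hsq 0) 0
  have h₂ := congrFun (congrFun hsq 1) 0
  simp [Matrix.mul_apply, Fin.sum_univ_two] at h₁ h₂
  obtain ⟨rfl, hb⟩ := eq_of_sq_eq_two h₁ h₂
  have e₁ := congrFun (congrFun hab 0) 0
  have e₂ := congrFun (congrFun hab 1) 0
  simp [hw, Matrix.mul_apply, Fin.sum_univ_two] at e₁ e₂
  rcases hb with rfl | rfl
  · refine Or.inl ⟨g.val 0 0, g.val 1 0, ?_⟩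
    ext i j
    fin_cases i <;> fin_cases j <;> simp [e₁, e₂]
  · refine Or.inr ⟨g.val 0 0, g.val 1 0, ?_⟩
    ext i j
    fin_cases i <;> fin_cases j <;>
      simp [cartanReflection, Matrix.mul_apply, Fin.sum_univ_two, e₁, e₂]

/-- Every element `g` of the normalizer of `A` in `GL₂(𝔽₅)` preserves the orbit of the
subalgebra `A₂` under conjugation by nonzero elements of `A`: there is a nonzero `h ∈ A`
with `gA₂g⁻¹ = hA₂h⁻¹`. -/
theorem normalizer_preserves_orbit_cartanA₂
    (g : (Matrix (Fin 2) (Fin 2) (ZMod 5))ˣ) (hg : conjSet (↑g) cartanA = cartanA) :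
    ∃ h ∈ cartanA, h ≠ 0 ∧ conjSet (↑g) cartanA₂ = conjSet h cartanA₂ := by
  have : Nontrivial (ZMod 5) := ⟨0, 1, by decide⟩
  rcases mem_cartanA_or_mul_cartanReflection_mem g hg with h | h
  · exact ⟨_, h, g.ne_zero, rfl⟩
  · refine ⟨_, h, Units.ne_zero _, ?_⟩
    rw [conjSet_units_mul, conjSet_cartanReflection_cartanA₂]
end

section
/- The set {hA₂h⁻¹ : h ∈ A, h ≠ 0} of conjugates of the subalgebra A₂ by units of A has exactly 3 elements. -/
theorem fact_prime_five : Fact (Nat.Prime 5) := ⟨by norm_num⟩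

section

attribute [local instance] fact_prime_five

/-- The subalgebra of `M₂(𝔽₅)` spanned by `1` and `!![-t, 3; 1, t]`. -/
def cartanTwist (t : ZMod 5) : Set (Matrix (Fin 2) (Fin 2) (ZMod 5)) :=
  {m | ∃ x y : ZMod 5, m = !![x - t * y, 3 * y; y, x + t * y]}

theorem cartanTwist_injective : Function.Injective cartanTwist := by
  intro s t hst
  have hs : !![-s, 3; 1, s] ∈ cartanTwist s := ⟨0, 1, by simp⟩
  rw [hst] at hs
  obtain ⟨x, y, h⟩ := hs
  have h00 := congrFun₂ h 0 0
  have h10 := congrFun₂ h 1 0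
  have h11 := congrFun₂ h 1 1
  simp only [Matrix.of_apply, Matrix.cons_val', Matrix.cons_val_zero, Matrix.cons_val_one,
    Matrix.cons_val_fin_one] at h00 h10 h11
  subst h10
  have h5 : (5 : ZMod 5) = 0 := by decide
  linear_combination 3 * h11 - 3 * h00 + (t - s) * h5

theorem sq_sub_two_mul_sq_ne_zero :
    ∀ {a b : ZMod 5}, (a ≠ 0 ∨ b ≠ 0) → a ^ 2 - 2 * b ^ 2 ≠ 0 := by
  decide

theorem sq_add_two_mul_sq_ne_zero :
    ∀ {a b : ZMod 5}, (a ≠ 0 ∨ b ≠ 0) → a ^ 2 + 2 * b ^ 2 ≠ 0 := by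
  decide

theorem conjSet_cartanA₂ {a b : ZMod 5} (hab : a ≠ 0 ∨ b ≠ 0) :
    conjSet !![a, 2 * b; b, a] cartanA₂ = cartanTwist (a * b / (a ^ 2 + 2 * b ^ 2)) := by
  have h5 : (5 : ZMod 5) = 0 := by decide
  have hD := sq_sub_two_mul_sq_ne_zero hab
  have hE := sq_add_two_mul_sq_ne_zero hab
  have hinv : Ring.inverse !![a, 2 * b; b, a] =
      (a ^ 2 - 2 * b ^ 2)⁻¹ • !![a, -(2 * b); -b, a] := by
    rw [← Matrix.nonsing_inv_eq_ringInverse, Matrix.inv_def, Matrix.adjugate_fin_two_of,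
      Matrix.det_fin_two_of, Ring.inverse_eq_inv']
    congr 2
    ring
  have key (x y : ZMod 5) :
      !![a, 2 * b; b, a] * !![x, 3 * y; y, x] * Ring.inverse !![a, 2 * b; b, a] =
        !![x - a * b / (a ^ 2 + 2 * b ^ 2) * (y * (a ^ 2 + 2 * b ^ 2) / (a ^ 2 - 2 * b ^ 2)),
          3 * (y * (a ^ 2 + 2 * b ^ 2) / (a ^ 2 - 2 * b ^ 2));
          y * (a ^ 2 + 2 * b ^ 2) / (a ^ 2 - 2 * b ^ 2),
          x + a * b / (a ^ 2 + 2 * b ^ 2) * (y * (a ^ 2 + 2 * b ^ 2) / (a ^ 2 - 2 * b ^ 2))] := by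
    rw [hinv, Matrix.mul_smul, Matrix.mul_fin_two, Matrix.mul_fin_two]
    ext i j
    fin_cases i <;> fin_cases j <;> simp <;> field_simp
    · ring
    · linear_combination (-2 * b ^ 2 * y) * h5
    · linear_combination (-b ^ 2 * y) * h5
    · ring
  ext m
  constructor
  · rintro ⟨_, ⟨x, y, rfl⟩, rfl⟩
    exact ⟨_, _, key x y⟩
  · rintro ⟨x, y, rfl⟩
    refine ⟨_, ⟨x, y * (a ^ 2 - 2 * b ^ 2) / (a ^ 2 + 2 * b ^ 2), rfl⟩, (key _ _).trans ?_⟩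
    have hy : y * (a ^ 2 - 2 * b ^ 2) / (a ^ 2 + 2 * b ^ 2) * (a ^ 2 + 2 * b ^ 2) /
        (a ^ 2 - 2 * b ^ 2) = y := by
      field_simp
    rw [hy]

theorem zmod_five_inv_eq_pow (x : ZMod 5) : x⁻¹ = x ^ 3 := by
  rcases eq_or_ne x 0 with rfl | hx
  · simp
  · refine inv_eq_of_mul_eq_one_right ?_
    rw [← pow_succ']
    exact ZMod.pow_card_sub_one_eq_one hx

theorem mul_div_sq_add_two_mul_sq_mem : ∀ a b : ZMod 5,
    a * b / (a ^ 2 + 2 * b ^ 2) ∈ ({0, 2, 3} : Finset (ZMod 5)) := by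
  simp only [div_eq_mul_inv, zmod_five_inv_eq_pow]
  decide

theorem exists_mul_div_sq_add_two_mul_sq_eq : ∀ t ∈ ({0, 2, 3} : Finset (ZMod 5)),
    ∃ a b : ZMod 5, (a ≠ 0 ∨ b ≠ 0) ∧ a * b / (a ^ 2 + 2 * b ^ 2) = t := by
  simp only [div_eq_mul_inv, zmod_five_inv_eq_pow]
  decide

theorem cartan_of_ne_zero_iff {a b : ZMod 5} :
    !![a, 2 * b; b, a] ≠ 0 ↔ a ≠ 0 ∨ b ≠ 0 := by
  rw [← not_and_or, not_iff_not]
  constructor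
  · intro h
    exact ⟨congrFun₂ h 0 0, congrFun₂ h 1 0⟩
  · rintro ⟨rfl, rfl⟩
    ext i j
    fin_cases i <;> fin_cases j <;> simp

end

theorem image_conjSet_cartanA₂ :
    (fun h => conjSet h cartanA₂) '' {h ∈ cartanA | h ≠ 0} =
      cartanTwist '' (({0, 2, 3} : Finset (ZMod 5)) : Set (ZMod 5)) := by
  ext S
  constructor
  · rintro ⟨_, ⟨⟨a, b, rfl⟩, h⟩, rfl⟩
    exact ⟨_, mul_div_sq_add_two_mul_sq_mem a b,
      (conjSet_cartanA₂ (cartan_of_ne_zero_iff.1 h)).symm⟩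
  · rintro ⟨t, ht, rfl⟩
    obtain ⟨a, b, hab, rfl⟩ := exists_mul_div_sq_add_two_mul_sq_eq t ht
    exact ⟨_, ⟨⟨a, b, rfl⟩, cartan_of_ne_zero_iff.2 hab⟩, conjSet_cartanA₂ hab⟩

/-- The set `{hA₂h⁻¹ : h ∈ A, h ≠ 0}` of conjugates of `A₂` by nonzero elements
(units) of `A` has exactly 3 elements. -/
theorem card_conjugates_cartanA₂ :
    Set.ncard ((fun h => conjSet h cartanA₂) '' {h ∈ cartanA | h ≠ 0}) = 3 := by
  rw [image_conjSet_cartanA₂, Set.ncard_image_of_injective _ cartanTwist_injective,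
    Set.ncard_coe_finset]
  rfl
end
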